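/- Let W be a simply-laced finite Weyl group and suppose x₁, x₂, y₁, y₂ ∈ W form a butterfly (x₁, x₂ ⋖ y₁, y₂ with x₁ ≠ x₂, y₁ ≠ y₂). Then there exists u ∈ W covered by both x₁ and x₂, and there exists z ∈ W covering both y₁ and y₂. -/

import Mathlib

open CoxeterSystem
open scoped RealInnerProductSpace

/-- A finite Weyl group: a Coxeter system `cs` on the finite group `W`, acting faithfully by
isometries on a Euclidean space `V`, together with a finite crystallographic root system `Φ`
with a choice of positive roots `pos`, such that the reflections of `W` are exactly the
reflections `sroot α` in positive roots `α`, the action permutes `Φ`, and the length of an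
element is the number of positive roots it sends to negative roots. -/
structure WeylSetup (B W V : Type*) [Group W] [NormedAddCommGroup V]
    [InnerProductSpace ℝ V] (M : CoxeterMatrix B) where
  cs : CoxeterSystem M W
  finW : Finite W
  act : W →* (V ≃ₗᵢ[ℝ] V)
  faithful : Function.Injective act
  Φ : Set V
  finΦ : Φ.Finite
  pos : Set V
  pos_subset : pos ⊆ Φ
  nonzero : ∀ α ∈ Φ, α ≠ (0 : V)
  neg_mem : ∀ α ∈ Φ, -α ∈ Φ
  pos_neg : ∀ α ∈ Φ, (α ∈ pos ↔ -α ∉ pos)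
  crystallographic : ∀ α ∈ Φ, ∀ β ∈ Φ, ∃ n : ℤ, 2 * ⟪β, α⟫ = (n : ℝ) * ⟪α, α⟫
  sroot : V → W
  sroot_isReflection : ∀ α ∈ Φ, cs.IsReflection (sroot α)
  sroot_apply : ∀ α ∈ Φ, ∀ v : V, act (sroot α) v = v - (2 * ⟪v, α⟫ / ⟪α, α⟫) • α
  reflection_eq_sroot : ∀ t : W, cs.IsReflection t → ∃ α ∈ pos, t = sroot α
  act_root : ∀ w : W, ∀ α ∈ Φ, act w α ∈ Φ
  length_eq : ∀ w : W, cs.length w = {α ∈ pos | act w α ∉ pos}.ncard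

variable {B W V : Type*} [Group W] [NormedAddCommGroup V] [InnerProductSpace ℝ V]
  {M : CoxeterMatrix B}

/-- The right inversion set `Inv_R(w) = {α ∈ Φ⁺ : w(α) ∈ Φ⁻}`. -/
def WeylSetup.invR (S : WeylSetup B W V M) (w : W) : Set V :=
  {α ∈ S.pos | S.act w α ∉ S.pos}

/-- Bruhat order (one step): right multiplication by a reflection increasing length. -/
def bruhatStep (cs : CoxeterSystem M W) (x y : W) : Prop :=
  ∃ t : W, cs.IsReflection t ∧ y = x * t ∧ cs.length x < cs.length y

/-- Bruhat order on a Coxeter group. -/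
def bruhatLE (cs : CoxeterSystem M W) : W → W → Prop :=
  Relation.ReflTransGen (bruhatStep cs)

/-- Cover relation in Bruhat order. -/
def bruhatCovBy (cs : CoxeterSystem M W) (x y : W) : Prop :=
  bruhatLE cs x y ∧ cs.length y = cs.length x + 1

namespace WeylSetup

variable (S : WeylSetup B W V M)

theorem act_mul (x y : W) (v : V) : S.act (x * y) v = S.act x (S.act y v) := by
  rw [map_mul]; rfl

theorem pos_or_neg {α : V} (hα : α ∈ S.Φ) : α ∈ S.pos ∨ -α ∈ S.pos := by
  by_cases h : -α ∈ S.pos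
  · exact Or.inr h
  · exact Or.inl ((S.pos_neg α hα).2 h)

theorem neg_notMem {α : V} (hα : α ∈ S.pos) : -α ∉ S.pos :=
  (S.pos_neg α (S.pos_subset hα)).1 hα

theorem sroot_mul_self {α : V} (hα : α ∈ S.Φ) : S.sroot α * S.sroot α = 1 :=
  (S.sroot_isReflection α hα).mul_self

theorem mul_sroot_cancel (x : W) {α : V} (hα : α ∈ S.Φ) :
    x * S.sroot α * S.sroot α = x := by
  rw [mul_assoc, S.sroot_mul_self hα, mul_one]

theorem act_sroot (hSL : ∀ α ∈ S.Φ, ⟪α, α⟫ = (2 : ℝ)) {α : V} (hα : α ∈ S.Φ) (v : V) :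
    S.act (S.sroot α) v = v - ⟪v, α⟫ • α := by
  rw [S.sroot_apply α hα, hSL α hα]
  congr 2
  ring

theorem act_sroot_self (hSL : ∀ α ∈ S.Φ, ⟪α, α⟫ = (2 : ℝ)) {α : V} (hα : α ∈ S.Φ) :
    S.act (S.sroot α) α = -α := by
  rw [S.act_sroot hSL hα, hSL α hα, two_smul]
  abel

theorem act_mul_sroot (hSL : ∀ α ∈ S.Φ, ⟪α, α⟫ = (2 : ℝ)) (w : W) {α : V} (hα : α ∈ S.Φ)
    (v : V) : S.act (w * S.sroot α) v = S.act w (v - ⟪v, α⟫ • α) := by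
  rw [act_mul, S.act_sroot hSL hα]

/-- Two roots of a simply-laced root system are equal, opposite, or have inner product
`1`, `0` or `-1`. -/
theorem inner_cases (hSL : ∀ α ∈ S.Φ, ⟪α, α⟫ = (2 : ℝ)) {α β : V} (hα : α ∈ S.Φ)
    (hβ : β ∈ S.Φ) :
    α = β ∨ α = -β ∨ ⟪α, β⟫ = (1 : ℝ) ∨ ⟪α, β⟫ = (0 : ℝ) ∨ ⟪α, β⟫ = (-1 : ℝ) := by
  obtain ⟨n, hn⟩ := S.crystallographic β hβ α hα
  rw [hSL β hβ] at hn
  have hn' : ⟪α, β⟫ = (n : ℝ) := by linarith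
  have h1 : ⟪α - β, α - β⟫ = 4 - 2 * (n : ℝ) := by
    rw [real_inner_sub_sub_self, hSL α hα, hSL β hβ, hn']; ring
  have h2 : ⟪α + β, α + β⟫ = 4 + 2 * (n : ℝ) := by
    rw [real_inner_add_add_self, hSL α hα, hSL β hβ, hn']; ring
  have h3 : n ≤ 2 := by
    have : (0 : ℝ) ≤ ⟪α - β, α - β⟫ := real_inner_self_nonneg
    have : (n : ℝ) ≤ 2 := by linarith
    exact_mod_cast this
  have h4 : -2 ≤ n := by
    have : (0 : ℝ) ≤ ⟪α + β, α + β⟫ := real_inner_self_nonneg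
    have : (-2 : ℝ) ≤ n := by linarith
    exact_mod_cast this
  interval_cases n
  · right; left
    have : α + β = 0 := by
      rw [← inner_self_eq_zero (𝕜 := ℝ), h2]; norm_num
    exact eq_neg_of_add_eq_zero_left this
  · simp [hn']
  · simp [hn']
  · simp [hn']
  · left
    have : α - β = 0 := by
      rw [← inner_self_eq_zero (𝕜 := ℝ), h1]; norm_num
    exact sub_eq_zero.1 this

theorem inner_cases_of_pos (hSL : ∀ α ∈ S.Φ, ⟪α, α⟫ = (2 : ℝ)) {α β : V} (hα : α ∈ S.pos)
    (hβ : β ∈ S.pos) (hne : α ≠ β) :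
    ⟪α, β⟫ = (1 : ℝ) ∨ ⟪α, β⟫ = (0 : ℝ) ∨ ⟪α, β⟫ = (-1 : ℝ) := by
  rcases S.inner_cases hSL (S.pos_subset hα) (S.pos_subset hβ) with h | h | h
  · exact absurd h hne
  · exact absurd (h ▸ hα) (S.neg_notMem hβ)
  · exact h

theorem inner_eq_neg_one_of_add_mem (hSL : ∀ α ∈ S.Φ, ⟪α, α⟫ = (2 : ℝ)) {α β : V}
    (hα : α ∈ S.Φ) (hβ : β ∈ S.Φ) (h : α + β ∈ S.Φ) : ⟪α, β⟫ = (-1 : ℝ) := by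
  have h' := hSL _ h
  rw [real_inner_add_add_self, hSL α hα, hSL β hβ] at h'
  linarith

theorem inner_eq_one_of_sub_mem (hSL : ∀ α ∈ S.Φ, ⟪α, α⟫ = (2 : ℝ)) {α β : V}
    (hα : α ∈ S.Φ) (hβ : β ∈ S.Φ) (h : α - β ∈ S.Φ) : ⟪α, β⟫ = (1 : ℝ) := by
  have h' := hSL _ h
  rw [real_inner_sub_sub_self, hSL α hα, hSL β hβ] at h'
  linarith

/-- A simple reflection makes exactly one positive root negative. -/
theorem eq_of_simple_notMem (i : B) {a b : V} (ha : a ∈ S.pos) (hb : b ∈ S.pos)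
    (ha' : S.act (S.cs.simple i) a ∉ S.pos) (hb' : S.act (S.cs.simple i) b ∉ S.pos) :
    a = b := by
  have h := S.length_eq (S.cs.simple i)
  rw [S.cs.length_simple] at h
  obtain ⟨c, hc⟩ := Set.ncard_eq_one.1 h.symm
  have h1 : a ∈ {α ∈ S.pos | S.act (S.cs.simple i) α ∉ S.pos} := ⟨ha, ha'⟩
  have h2 : b ∈ {α ∈ S.pos | S.act (S.cs.simple i) α ∉ S.pos} := ⟨hb, hb'⟩
  rw [hc] at h1 h2
  exact h1.trans h2.symm

theorem simple_act_mem_of_sum_zero (hSL : ∀ α ∈ S.Φ, ⟪α, α⟫ = (2 : ℝ)) (i : B) {a b c : V}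
    (ha : a ∈ S.pos) (hb : b ∈ S.pos) (hc : c ∈ S.pos) (h : a + b + c = 0) :
    S.act (S.cs.simple i) a ∈ S.pos := by
  by_contra hn
  obtain ⟨δ, hδ, hs⟩ := S.reflection_eq_sroot _ (S.cs.isReflection_simple i)
  have hδn : S.act (S.cs.simple i) δ ∉ S.pos := by
    rw [hs, S.act_sroot_self hSL (S.pos_subset hδ)]
    exact S.neg_notMem hδ
  obtain rfl := S.eq_of_simple_notMem i ha hδ hn hδn
  have hba : b + a = -c := by
    rw [add_comm]; exact eq_neg_of_add_eq_zero_left h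
  have hin := S.inner_eq_neg_one_of_add_mem hSL (S.pos_subset hb) (S.pos_subset ha)
    (hba ▸ S.neg_mem c (S.pos_subset hc))
  have hbn : S.act (S.cs.simple i) b ∉ S.pos := by
    rw [hs, S.act_sroot hSL (S.pos_subset ha), hin, neg_one_smul, sub_neg_eq_add, hba]
    exact S.neg_notMem hc
  obtain rfl := S.eq_of_simple_notMem i hb ha hbn hn
  rw [hSL b (S.pos_subset hb)] at hin
  norm_num at hin

theorem act_mem_of_sum_zero (hSL : ∀ α ∈ S.Φ, ⟪α, α⟫ = (2 : ℝ)) (w : W) :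
    ∀ {a b c : V}, a ∈ S.pos → b ∈ S.pos → c ∈ S.pos → a + b + c = 0 →
      S.act w a ∈ S.pos := by
  induction w using S.cs.simple_induction_right with
  | one =>
    intro a b c ha _ _ _
    rw [map_one]
    exact ha
  | mul_simple_right w i ih =>
    intro a b c ha hb hc h
    rw [act_mul]
    refine ih (S.simple_act_mem_of_sum_zero hSL i ha hb hc h)
      (S.simple_act_mem_of_sum_zero hSL i hb hc ha (by rw [← h]; abel))
      (S.simple_act_mem_of_sum_zero hSL i hc ha hb (by rw [← h]; abel)) ?_
    rw [← map_add, ← map_add, h, map_zero]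

/-- Positive roots are closed under addition. -/
theorem add_mem (hSL : ∀ α ∈ S.Φ, ⟪α, α⟫ = (2 : ℝ)) {a b : V} (ha : a ∈ S.pos)
    (hb : b ∈ S.pos) (h : a + b ∈ S.Φ) : a + b ∈ S.pos := by
  rcases S.pos_or_neg h with h' | h'
  · exact h'
  · have := S.act_mem_of_sum_zero hSL (S.sroot a) ha hb h' (by abel)
    rw [S.act_sroot_self hSL (S.pos_subset ha)] at this
    exact absurd this (S.neg_notMem ha)

/-- The decompositions `β = γ + (β - γ)` into positive roots that `w` keeps positive. -/
def splittings (w : W) (β : V) : Set V :=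
  {γ ∈ S.pos | β - γ ∈ S.pos ∧ S.act w γ ∈ S.pos ∧ S.act w (β - γ) ∈ S.pos}

theorem finite_of_subset_pos {s : Set V} (h : s ⊆ S.pos) : s.Finite :=
  S.finΦ.subset (h.trans S.pos_subset)

theorem ncard_invR_inter_preserved (w : W) {β : V} (hβ : β ∈ S.Φ) :
    (S.invR (w * S.sroot β) ∩ {γ | S.act (S.sroot β) γ ∈ S.pos}).ncard =
      (S.invR w ∩ {γ | S.act (S.sroot β) γ ∈ S.pos}).ncard := by
  have hinv (v : V) : S.act (S.sroot β) (S.act (S.sroot β) v) = v := by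
    rw [← act_mul, S.sroot_mul_self hβ, map_one]; rfl
  rw [← Set.ncard_image_of_injective (S.invR w ∩ {γ | S.act (S.sroot β) γ ∈ S.pos})
    (S.act (S.sroot β)).injective]
  congr 1
  ext γ
  simp only [invR, act_mul, Set.mem_inter_iff, Set.mem_ofPred_eq, Set.mem_image]
  constructor
  · rintro ⟨⟨h1, h2⟩, h3⟩
    exact ⟨S.act (S.sroot β) γ, ⟨⟨h3, h2⟩, by rwa [hinv]⟩, hinv γ⟩
  · rintro ⟨δ, ⟨⟨h1, h2⟩, h3⟩, rfl⟩
    rw [hinv]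
    exact ⟨⟨h3, h2⟩, h1⟩

theorem invR_diff_preserved (hSL : ∀ α ∈ S.Φ, ⟪α, α⟫ = (2 : ℝ)) (w : W) {β : V}
    (hβ : β ∈ S.pos) (hw : S.act w β ∈ S.pos) :
    S.invR (w * S.sroot β) \ {γ | S.act (S.sroot β) γ ∈ S.pos} =
      (S.invR w \ {γ | S.act (S.sroot β) γ ∈ S.pos}) ∪ insert β (S.splittings w β) := by
  have hβΦ := S.pos_subset hβ
  have hwβ : -S.act w β ∉ S.pos := S.neg_notMem hw
  ext γ
  simp only [invR, splittings, act_mul, Set.mem_sdiff, Set.mem_ofPred_eq, Set.mem_union,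
    Set.mem_insert_iff]
  by_cases hγβ : γ = β
  · subst hγβ
    simp [S.act_sroot_self hSL hβΦ, hwβ, hβ, S.neg_notMem hβ]
  by_cases hγ : γ ∈ S.pos
  swap
  · simp [hγ, hγβ]
  have hγΦ := S.pos_subset hγ
  have hsΦ := S.act_root (S.sroot β) γ hγΦ
  by_cases hs : S.act (S.sroot β) γ ∈ S.pos
  · simp only [hs, not_true_eq_false, and_false, hγβ, false_or, false_iff]
    rintro ⟨-, h1, -, -⟩
    have hi := S.inner_eq_one_of_sub_mem hSL hβΦ hγΦ (S.pos_subset h1)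
    rw [real_inner_comm] at hi
    rw [S.act_sroot hSL hβΦ, hi, one_smul] at hs
    exact S.neg_notMem h1 (by rwa [neg_sub])
  have hi : ⟪γ, β⟫ = (1 : ℝ) := by
    rcases S.inner_cases_of_pos hSL hγ hβ hγβ with h | h | h
    · exact h
    · rw [S.act_sroot hSL hβΦ, h, zero_smul, sub_zero] at hs
      exact absurd hγ hs
    · rw [S.act_sroot hSL hβΦ, h, neg_one_smul, sub_neg_eq_add] at hs hsΦ
      exact absurd (S.add_mem hSL hγ hβ hsΦ) hs
  have hse : S.act (S.sroot β) γ = γ - β := by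
    rw [S.act_sroot hSL hβΦ, hi, one_smul]
  rw [hse] at hs hsΦ ⊢
  have hd : β - γ ∈ S.pos := by
    rw [← neg_sub]; exact (S.pos_or_neg hsΦ).resolve_left hs
  have hwd : S.act w (γ - β) ∉ S.pos ↔ S.act w (β - γ) ∈ S.pos := by
    have := S.pos_neg _ (S.act_root w _ (S.pos_subset hd))
    rw [this, ← map_neg, neg_sub]
  simp only [hγ, hs, hd, hwd, hγβ, true_and, and_true, not_false_eq_true, false_or]
  constructor
  · intro h
    by_cases h' : S.act w γ ∈ S.pos
    · exact Or.inr ⟨h', h⟩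
    · exact Or.inl h'
  · rintro (h | h)
    · by_contra hn
      have hn' : S.act w (γ - β) ∈ S.pos := by
        by_contra h'
        exact hn (hwd.1 h')
      refine h ?_
      have he : S.act w γ = S.act w (γ - β) + S.act w β := by
        rw [← map_add, sub_add_cancel]
      rw [he]
      exact S.add_mem hSL hn' hw (he ▸ S.act_root w γ hγΦ)
    · exact h.2

/-- If `w β` is positive then `ℓ(w s_β) = ℓ(w) + 1 + #(splittings of β)`. -/
theorem length_mul_sroot (hSL : ∀ α ∈ S.Φ, ⟪α, α⟫ = (2 : ℝ)) (w : W) {β : V}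
    (hβ : β ∈ S.pos) (hw : S.act w β ∈ S.pos) :
    S.cs.length (w * S.sroot β) = S.cs.length w + 1 + (S.splittings w β).ncard := by
  have hlen (v : W) : S.cs.length v = (S.invR v).ncard := S.length_eq v
  have hinvR (v : W) : S.invR v ⊆ S.pos := fun _ h => h.1
  have hsplit : S.splittings w β ⊆ S.pos := fun _ h => h.1
  have hfin := S.finite_of_subset_pos (hinvR w)
  have hβs : β ∉ S.splittings w β := by
    rintro ⟨-, h, -⟩
    rw [sub_self] at h
    exact S.nonzero 0 (S.pos_subset h) rfl
  have hdisj : Disjoint (S.invR w \ {γ | S.act (S.sroot β) γ ∈ S.pos})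
      (insert β (S.splittings w β)) := by
    rw [Set.disjoint_left]
    rintro γ ⟨⟨-, h⟩, -⟩ (rfl | h')
    · exact h hw
    · exact h h'.2.2.1
  rw [hlen, hlen, ← Set.ncard_inter_add_ncard_sdiff_eq_ncard (S.invR (w * S.sroot β))
      {γ | S.act (S.sroot β) γ ∈ S.pos} (S.finite_of_subset_pos (hinvR _)),
    ← Set.ncard_inter_add_ncard_sdiff_eq_ncard (S.invR w)
      {γ | S.act (S.sroot β) γ ∈ S.pos} hfin,
    S.ncard_invR_inter_preserved w (S.pos_subset hβ), S.invR_diff_preserved hSL w hβ hw,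
    Set.ncard_union_eq hdisj hfin.sdiff ((S.finite_of_subset_pos hsplit).insert β),
    Set.ncard_insert_of_notMem hβs (S.finite_of_subset_pos hsplit)]
  ring

theorem length_le_of_bruhatLE {cs : CoxeterSystem M W} {x y : W} (h : bruhatLE cs x y) :
    cs.length x ≤ cs.length y := by
  induction h with
  | refl => exact le_rfl
  | tail _ h ih =>
    obtain ⟨_, _, _, h⟩ := h
    exact ih.trans h.le

theorem exists_reflection_of_bruhatCovBy {cs : CoxeterSystem M W} {x y : W}
    (h : bruhatCovBy cs x y) : ∃ t, cs.IsReflection t ∧ y = x * t := by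
  obtain ⟨h, hl⟩ := h
  rcases Relation.ReflTransGen.cases_head h with rfl | ⟨c, ⟨t, ht, hc, hlt⟩, hcy⟩
  · omega
  rcases Relation.ReflTransGen.cases_head hcy with rfl | ⟨d, ⟨-, -, -, hlt'⟩, hdy⟩
  · exact ⟨t, ht, hc⟩
  · have := length_le_of_bruhatLE hdy
    omega

/-- `x β` is positive and `β` has no splitting; equivalently, `x s_β` covers `x`. -/
structure IsCoverRoot (x : W) (β : V) : Prop where
  pos : β ∈ S.pos
  act_pos : S.act x β ∈ S.pos
  no_splitting : ∀ γ ∈ S.pos, β - γ ∈ S.pos → S.act x γ ∈ S.pos → S.act x (β - γ) ∉ S.pos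

variable {S}

theorem exists_isCoverRoot (hSL : ∀ α ∈ S.Φ, ⟪α, α⟫ = (2 : ℝ)) {x y : W}
    (h : bruhatCovBy S.cs x y) : ∃ β, S.IsCoverRoot x β ∧ y = x * S.sroot β := by
  obtain ⟨t, ht, rfl⟩ := exists_reflection_of_bruhatCovBy h
  obtain ⟨β, hβ, rfl⟩ := S.reflection_eq_sroot t ht
  have hl := h.2
  have hβΦ := S.pos_subset hβ
  have hx : S.act x β ∈ S.pos := by
    refine (S.pos_or_neg (S.act_root x β hβΦ)).resolve_right fun hn => ?_
    have := S.length_mul_sroot hSL (x * S.sroot β) hβ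
      (by rwa [act_mul, S.act_sroot_self hSL hβΦ, map_neg])
    rw [S.mul_sroot_cancel x hβΦ] at this
    omega
  have hc := S.length_mul_sroot hSL x hβ hx
  have h0 : (S.splittings x β).ncard = 0 := by omega
  rw [Set.ncard_eq_zero (S.finite_of_subset_pos fun _ h => h.1)] at h0
  refine ⟨β, ⟨hβ, hx, fun γ h1 h2 h3 h4 => ?_⟩, rfl⟩
  have : γ ∈ S.splittings x β := ⟨h1, h2, h3, h4⟩
  rw [h0] at this
  exact this

theorem IsCoverRoot.bruhatCovBy (hSL : ∀ α ∈ S.Φ, ⟪α, α⟫ = (2 : ℝ)) {x : W} {β : V}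
    (h : S.IsCoverRoot x β) : bruhatCovBy S.cs x (x * S.sroot β) := by
  have h0 : S.splittings x β = ∅ :=
    Set.eq_empty_of_forall_notMem fun γ hγ => h.no_splitting γ hγ.1 hγ.2.1 hγ.2.2.1 hγ.2.2.2
  have hc := S.length_mul_sroot hSL x h.pos h.act_pos
  rw [h0, Set.ncard_empty] at hc
  exact ⟨Relation.ReflTransGen.single
    ⟨_, S.sroot_isReflection β (S.pos_subset h.pos), rfl, by omega⟩, hc⟩

/-- If `α = γ + δ` and `⟪α, β⟫ = -1` for positive roots, then `s_β` adds `β` to one of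
`γ`, `δ` and fixes the other. -/
theorem sroot_splitting (hSL : ∀ α ∈ S.Φ, ⟪α, α⟫ = (2 : ℝ)) {α β γ : V} (hα : α ∈ S.pos)
    (hβ : β ∈ S.pos) (hαβ : ⟪α, β⟫ = (-1 : ℝ)) (hγ : γ ∈ S.pos) (hδ : α - γ ∈ S.pos) :
    (⟪γ, β⟫ = (-1 : ℝ) ∧ ⟪α - γ, β⟫ = (0 : ℝ)) ∨
      (⟪γ, β⟫ = (0 : ℝ) ∧ ⟪α - γ, β⟫ = (-1 : ℝ)) := by
  have hsub : ⟪α - γ, β⟫ = (-1 : ℝ) - ⟪γ, β⟫ := by rw [inner_sub_left, hαβ]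
  have hγβ : γ ≠ β := by
    rintro rfl
    have := S.inner_eq_one_of_sub_mem hSL (S.pos_subset hα) (S.pos_subset hβ) (S.pos_subset hδ)
    linarith
  have hδβ : α - γ ≠ β := by
    rintro h
    have := S.inner_eq_one_of_sub_mem hSL (S.pos_subset hα) (S.pos_subset hβ)
      (by rw [← h, sub_sub_cancel]; exact S.pos_subset hγ)
    linarith
  rcases S.inner_cases_of_pos hSL hγ hβ hγβ with h | h | h <;>
    rcases S.inner_cases_of_pos hSL hδ hβ hδβ with h' | h' | h' <;>
    first
    | exact Or.inl ⟨h, h'⟩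
    | exact Or.inr ⟨h, h'⟩
    | (exfalso; linarith)

/-- If `x s_{α + β}` covers `x`, then `x s_β s_α` covers `x s_β`. -/
theorem IsCoverRoot.of_add (hSL : ∀ α ∈ S.Φ, ⟪α, α⟫ = (2 : ℝ)) {x : W} {α β : V}
    (hα : α ∈ S.pos) (hβ : β ∈ S.pos) (h : S.IsCoverRoot x (α + β)) :
    S.IsCoverRoot (x * S.sroot β) α := by
  have hβΦ := S.pos_subset hβ
  have hαβ := S.inner_eq_neg_one_of_add_mem hSL (S.pos_subset hα) hβΦ (S.pos_subset h.pos)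
  refine ⟨hα, ?_, fun γ hγ hδ h1 h2 => ?_⟩
  · rw [S.act_mul_sroot hSL _ hβΦ, hαβ, neg_one_smul, sub_neg_eq_add]
    exact h.act_pos
  have hadd {ε : V} (hε : ε ∈ S.pos) (hi : ⟪ε, β⟫ = (-1 : ℝ)) : ε + β ∈ S.pos := by
    refine S.add_mem hSL hε hβ ?_
    have := S.act_root (S.sroot β) ε (S.pos_subset hε)
    rwa [S.act_sroot hSL hβΦ, hi, neg_one_smul, sub_neg_eq_add] at this
  rw [S.act_mul_sroot hSL _ hβΦ] at h1 h2
  rcases sroot_splitting hSL hα hβ hαβ hγ hδ with ⟨hi, hj⟩ | ⟨hi, hj⟩ <;>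
    simp only [hi, hj, neg_one_smul, sub_neg_eq_add, zero_smul, sub_zero] at h1 h2
  · have he : α + β - (γ + β) = α - γ := by abel
    exact h.no_splitting (γ + β) (hadd hγ hi) (he ▸ hδ) h1 (he ▸ h2)
  · have he : α + β - γ = α - γ + β := by abel
    exact h.no_splitting γ hγ (he ▸ hadd hδ hj) h1 (he ▸ h2)

/-- If `u s_β s_α` covers `u s_β`, then `u s_α` covers `u`. -/
theorem IsCoverRoot.of_mul_sroot (hSL : ∀ α ∈ S.Φ, ⟪α, α⟫ = (2 : ℝ)) {u : W} {α β : V}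
    (hβ : β ∈ S.pos) (hαβ : ⟪α, β⟫ = (-1 : ℝ)) (huα : S.act u α ∈ S.pos)
    (huβ : S.act u β ∈ S.pos) (h : S.IsCoverRoot (u * S.sroot β) α) :
    S.IsCoverRoot u α := by
  have hβΦ := S.pos_subset hβ
  refine ⟨h.pos, huα, fun γ hγ hδ h1 h2 => ?_⟩
  have hadd {ε : V} (hε : ε ∈ S.pos) (hi : ⟪ε, β⟫ = (-1 : ℝ)) (hu : S.act u ε ∈ S.pos) :
      S.act (u * S.sroot β) ε ∈ S.pos := by
    have hr := S.act_root (u * S.sroot β) ε (S.pos_subset hε)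
    rw [S.act_mul_sroot hSL _ hβΦ, hi, neg_one_smul, sub_neg_eq_add, map_add] at hr ⊢
    exact S.add_mem hSL hu huβ hr
  have hfix {ε : V} (hi : ⟪ε, β⟫ = (0 : ℝ)) (hu : S.act u ε ∈ S.pos) :
      S.act (u * S.sroot β) ε ∈ S.pos := by
    rwa [S.act_mul_sroot hSL _ hβΦ, hi, zero_smul, sub_zero]
  rcases sroot_splitting hSL h.pos hβ hαβ hγ hδ with ⟨hi, hj⟩ | ⟨hi, hj⟩
  · exact h.no_splitting γ hγ hδ (hadd hγ hi h1) (hfix hj h2)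
  · exact h.no_splitting γ hγ hδ (hfix hi h1) (hadd hδ hj h2)

theorem sroot_add_mul_sroot (hSL : ∀ α ∈ S.Φ, ⟪α, α⟫ = (2 : ℝ)) {α β : V} (hα : α ∈ S.Φ)
    (hβ : β ∈ S.Φ) (h : α + β ∈ S.Φ) :
    S.sroot (α + β) * S.sroot α = S.sroot α * S.sroot β := by
  have hi := S.inner_eq_neg_one_of_add_mem hSL hα hβ h
  have hi' : ⟪β, α⟫ = (-1 : ℝ) := by rw [real_inner_comm, hi]
  apply S.faithful
  ext v
  simp only [act_mul, S.act_sroot hSL hα, S.act_sroot hSL hβ, S.act_sroot hSL h,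
    inner_sub_left, inner_add_right, inner_smul_left, hSL α hα, hi, hi', RCLike.conj_to_real]
  module

theorem butterfly_of_isCoverRoot (hSL : ∀ α ∈ S.Φ, ⟪α, α⟫ = (2 : ℝ)) {x₁ x₂ : W} {α β : V}
    (hxx : x₁ * S.sroot α = x₂ * S.sroot β) (h1 : S.IsCoverRoot x₁ (α + β))
    (h1' : S.IsCoverRoot x₁ β) (h2' : S.IsCoverRoot x₂ α) :
    bruhatCovBy S.cs (x₁ * S.sroot α) x₁ ∧
      bruhatCovBy S.cs (x₁ * S.sroot β) (x₁ * S.sroot β * S.sroot α) := by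
  have hαΦ := S.pos_subset h2'.pos
  have hβΦ := S.pos_subset h1'.pos
  have hαβ := S.inner_eq_neg_one_of_add_mem hSL hαΦ hβΦ (S.pos_subset h1.pos)
  refine ⟨?_, (IsCoverRoot.of_add hSL h2'.pos h1'.pos h1).bruhatCovBy hSL⟩
  have hxα : S.act x₁ α ∉ S.pos := fun h =>
    h1.no_splitting α h2'.pos (by rw [add_sub_cancel_left]; exact h1'.pos) h
      (by rw [add_sub_cancel_left]; exact h1'.act_pos)
  have huα : S.act (x₁ * S.sroot α) α ∈ S.pos := by
    rw [act_mul, S.act_sroot_self hSL hαΦ, map_neg]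
    exact (S.pos_or_neg (S.act_root x₁ α hαΦ)).resolve_left hxα
  have huβ : S.act (x₁ * S.sroot α) β ∈ S.pos := by
    rw [S.act_mul_sroot hSL _ hαΦ, real_inner_comm, hαβ, neg_one_smul, sub_neg_eq_add,
      add_comm]
    exact h1.act_pos
  have hcov : S.IsCoverRoot (x₁ * S.sroot α) α := by
    refine IsCoverRoot.of_mul_sroot hSL h1'.pos hαβ huα huβ ?_
    rwa [hxx, S.mul_sroot_cancel _ hβΦ]
  have := hcov.bruhatCovBy hSL
  rwa [S.mul_sroot_cancel _ hαΦ] at this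

/-- The conclusion for a butterfly inside a coset of a reflection subgroup of type `A₂`. -/
theorem exists_bounds_of_isCoverRoot (hSL : ∀ α ∈ S.Φ, ⟪α, α⟫ = (2 : ℝ)) {x₁ x₂ : W}
    {α β : V} (hy : x₁ * S.sroot (α + β) = x₂ * S.sroot α)
    (h1 : S.IsCoverRoot x₁ (α + β)) (h1' : S.IsCoverRoot x₁ β)
    (h2 : S.IsCoverRoot x₂ (α + β)) (h2' : S.IsCoverRoot x₂ α) :
    (∃ u, bruhatCovBy S.cs u x₁ ∧ bruhatCovBy S.cs u x₂) ∧
      ∃ z, bruhatCovBy S.cs (x₁ * S.sroot (α + β)) z ∧ bruhatCovBy S.cs (x₁ * S.sroot β) z := by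
  have hαΦ := S.pos_subset h2'.pos
  have hβΦ := S.pos_subset h1'.pos
  have hsΦ := S.pos_subset h1.pos
  have e1 := sroot_add_mul_sroot hSL hαΦ hβΦ hsΦ
  have e2 := sroot_add_mul_sroot hSL hβΦ hαΦ (by rwa [add_comm])
  rw [add_comm] at e2
  have hx2 : x₂ = x₁ * S.sroot α * S.sroot β := by
    rw [mul_assoc, ← e1, ← mul_assoc, hy, S.mul_sroot_cancel _ hαΦ]
  have hxx : x₁ * S.sroot α = x₂ * S.sroot β := by
    rw [hx2, S.mul_sroot_cancel _ hβΦ]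
  have hz : x₁ * S.sroot β * S.sroot α = x₂ * S.sroot α * S.sroot β := by
    rw [← hy, mul_assoc, mul_assoc, e2]
  obtain ⟨hu1, hz1⟩ := butterfly_of_isCoverRoot hSL hxx h1 h1' h2'
  obtain ⟨hu2, hz2⟩ := butterfly_of_isCoverRoot hSL hxx.symm (by rwa [add_comm]) h2' h1'
  rw [← hxx] at hu2
  rw [← hz, ← hy] at hz2
  exact ⟨⟨_, hu1, hu2⟩, _, hz2, hz1⟩

theorem exists_combination_of_sroot_mul_eq (hSL : ∀ α ∈ S.Φ, ⟪α, α⟫ = (2 : ℝ)) {a b c d : V}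
    (ha : a ∈ S.pos) (hb : b ∈ S.pos) (hc : c ∈ S.pos) (hd : d ∈ S.pos) (hcd : c ≠ d)
    (h : S.sroot a * S.sroot b = S.sroot c * S.sroot d) :
    ∃ r s : ℝ, c = r • a + s • b := by
  have hdc : ⟪d, c⟫ = ⟪c, d⟫ := real_inner_comm _ _
  have hv := congrArg (fun w => S.act w ((2 : ℝ) • c - ⟪c, d⟫ • d)) h
  simp only [act_mul, S.act_sroot hSL (S.pos_subset ha), S.act_sroot hSL (S.pos_subset hb),
    S.act_sroot hSL (S.pos_subset hc), S.act_sroot hSL (S.pos_subset hd)] at hv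
  set v := (2 : ℝ) • c - ⟪c, d⟫ • d with hvdef
  have h1 : ⟪v, d⟫ = (0 : ℝ) := by
    simp only [hvdef, inner_sub_left, inner_smul_left, hSL d (S.pos_subset hd),
      RCLike.conj_to_real]
    ring
  have h2 : ⟪v, c⟫ = 4 - ⟪c, d⟫ ^ 2 := by
    simp only [hvdef, inner_sub_left, inner_smul_left, hSL c (S.pos_subset hc), hdc,
      RCLike.conj_to_real]
    ring
  have h3 : (4 - ⟪c, d⟫ ^ 2 : ℝ) ≠ 0 := by
    rcases S.inner_cases_of_pos hSL hc hd hcd with h | h | h <;> rw [h] <;> norm_num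
  rw [h1, zero_smul, sub_zero, h2] at hv
  refine ⟨(4 - ⟪c, d⟫ ^ 2)⁻¹ * ⟪v - ⟪v, b⟫ • b, a⟫, (4 - ⟪c, d⟫ ^ 2)⁻¹ * ⟪v, b⟫, ?_⟩
  rw [mul_smul, mul_smul, ← smul_add, eq_inv_smul_iff₀ h3]
  rw [← sub_eq_zero] at hv ⊢
  rw [← hv]
  abel

/-- The positive roots in the plane spanned by two positive roots. -/
theorem mem_plane_cases (hSL : ∀ α ∈ S.Φ, ⟪α, α⟫ = (2 : ℝ)) {a b c : V}
    (ha : a ∈ S.pos) (hb : b ∈ S.pos) (hc : c ∈ S.pos) (hab : a ≠ b)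
    (h : ∃ r s : ℝ, c = r • a + s • b) :
    c = a ∨ c = b ∨ (⟪a, b⟫ = (1 : ℝ) ∧ (c = a - b ∨ c = b - a)) ∨
      (⟪a, b⟫ = (-1 : ℝ) ∧ c = a + b) := by
  obtain ⟨r, s, hrs⟩ := h
  by_cases hca : c = a
  · exact Or.inl hca
  by_cases hcb : c = b
  · exact Or.inr (Or.inl hcb)
  have hba : ⟪b, a⟫ = ⟪a, b⟫ := real_inner_comm _ _
  have e1 : ⟪c, a⟫ = r * 2 + s * ⟪a, b⟫ := by
    rw [hrs, inner_add_left, real_inner_smul_left, real_inner_smul_left,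
      hSL a (S.pos_subset ha), hba]
  have e2 : ⟪c, b⟫ = r * ⟪a, b⟫ + s * 2 := by
    rw [hrs, inner_add_left, real_inner_smul_left, real_inner_smul_left,
      hSL b (S.pos_subset hb)]
  have e3 : r * ⟪c, a⟫ + s * ⟪c, b⟫ = 2 := by
    rw [← hSL c (S.pos_subset hc), ← real_inner_smul_right, ← real_inner_smul_right,
      ← inner_add_right, ← hrs]
  have key (r' s' : ℝ) (hr : r = r') (hs : s = s') : c = r' • a + s' • b := by
    rw [hrs, hr, hs]
  right; right
  rcases S.inner_cases_of_pos hSL ha hb hab with h | h | h <;>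
    rcases S.inner_cases_of_pos hSL hc ha hca with h' | h' | h' <;>
    rcases S.inner_cases_of_pos hSL hc hb hcb with h'' | h'' | h'' <;>
    rw [h, h'] at e1 <;> rw [h, h''] at e2 <;> rw [h', h''] at e3 <;>
    try (exfalso; linarith)
  · have := key 1 (-1) (by linarith) (by linarith)
    exact Or.inl ⟨h, Or.inl (by rw [this]; module)⟩
  · have := key (-1) 1 (by linarith) (by linarith)
    exact Or.inl ⟨h, Or.inr (by rw [this]; module)⟩
  · have := key 1 1 (by linarith) (by linarith)
    exact Or.inr ⟨h, by rw [this]; module⟩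
  · have hc' : c = -(a + b) := by
      rw [key (-1) (-1) (by linarith) (by linarith)]; module
    have hsum : a + b = -c := by rw [hc', neg_neg]
    have := S.add_mem hSL ha hb (hsum ▸ S.neg_mem c (S.pos_subset hc))
    exact absurd (hsum ▸ this) (S.neg_notMem hc)

end WeylSetup

/-- In a simply-laced finite Weyl group, every butterfly `x₁, x₂ ⋖ y₁, y₂` has a common
lower cover `u ⋖ x₁, x₂` and a common upper cover `y₁, y₂ ⋖ z`. -/
theorem stmt13 (S : WeylSetup B W V M)
    (hSL : ∀ α ∈ S.Φ, ⟪α, α⟫ = (2 : ℝ))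
    (x₁ x₂ y₁ y₂ : W) (hx : x₁ ≠ x₂) (hy : y₁ ≠ y₂)
    (h11 : bruhatCovBy S.cs x₁ y₁) (h12 : bruhatCovBy S.cs x₁ y₂)
    (h21 : bruhatCovBy S.cs x₂ y₁) (h22 : bruhatCovBy S.cs x₂ y₂) :
    (∃ u : W, bruhatCovBy S.cs u x₁ ∧ bruhatCovBy S.cs u x₂) ∧
    (∃ z : W, bruhatCovBy S.cs y₁ z ∧ bruhatCovBy S.cs y₂ z) := by
  obtain ⟨a, hxa, hya⟩ := WeylSetup.exists_isCoverRoot hSL h11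
  obtain ⟨c, hxc, hyc⟩ := WeylSetup.exists_isCoverRoot hSL h12
  obtain ⟨b, hxb, hyb⟩ := WeylSetup.exists_isCoverRoot hSL h21
  obtain ⟨d, hxd, hyd⟩ := WeylSetup.exists_isCoverRoot hSL h22
  have ha := S.pos_subset hxa.pos
  have hb := S.pos_subset hxb.pos
  have hc := S.pos_subset hxc.pos
  have hd := S.pos_subset hxd.pos
  have hx2 : x₂ = x₁ * S.sroot a * S.sroot b := by
    rw [← hya, hyb, S.mul_sroot_cancel _ hb]
  have hx2' : x₂ = x₁ * S.sroot c * S.sroot d := by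
    rw [← hyc, hyd, S.mul_sroot_cancel _ hd]
  have hab : a ≠ b := by
    rintro rfl
    exact hx (by rw [hx2, S.mul_sroot_cancel _ ha])
  have hcd : c ≠ d := by
    rintro rfl
    exact hx (by rw [hx2', S.mul_sroot_cancel _ hc])
  have hac : a ≠ c := by
    rintro rfl
    exact hy (hya.trans hyc.symm)
  have hbd : b ≠ d := by
    rintro rfl
    exact hy (hyb.trans hyd.symm)
  have heq : S.sroot a * S.sroot b = S.sroot c * S.sroot d := by
    rw [hx2, mul_assoc, mul_assoc] at hx2'
    exact mul_left_cancel hx2'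
  have heq' : S.sroot b * S.sroot a = S.sroot d * S.sroot c := by
    have := congrArg (·⁻¹) heq
    simpa only [mul_inv_rev, (S.sroot_isReflection _ ha).inv, (S.sroot_isReflection _ hb).inv,
      (S.sroot_isReflection _ hc).inv, (S.sroot_isReflection _ hd).inv] using this
  have hcomb := WeylSetup.exists_combination_of_sroot_mul_eq hSL hxa.pos hxb.pos hxc.pos hxd.pos hcd heq
  have hcomb' := WeylSetup.exists_combination_of_sroot_mul_eq hSL hxb.pos hxa.pos hxd.pos hxc.pos
    hcd.symm heq'
  have hba : ⟪b, a⟫ = (⟪a, b⟫ : ℝ) := real_inner_comm _ _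
  have hcases := S.mem_plane_cases hSL hxa.pos hxb.pos hxc.pos hab hcomb
  have hcases' := S.mem_plane_cases hSL hxb.pos hxa.pos hxd.pos hab.symm hcomb'
  have hnb : -S.act x₁ (b - ⟪b, a⟫ • a) ∈ S.pos := by
    have := hxb.act_pos
    rwa [hx2, WeylSetup.act_mul, S.act_sroot_self hSL hb, map_neg, S.act_mul_sroot hSL _ ha] at this
  have hnd : -S.act x₁ (d - ⟪d, c⟫ • c) ∈ S.pos := by
    have := hxd.act_pos
    rwa [hx2', WeylSetup.act_mul, S.act_sroot_self hSL hd, map_neg, S.act_mul_sroot hSL _ hc] at this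
  have hcontra {v : V} (h : S.act x₁ v ∈ S.pos) : -S.act x₁ v ∉ S.pos := S.neg_notMem h
  rcases S.inner_cases_of_pos hSL hxa.pos hxb.pos hab with hp | hp | hp <;>
    simp only [hba, hp, hac.symm, hbd.symm, false_or, one_smul, zero_smul, sub_zero,
      neg_one_smul, sub_neg_eq_add] at hcases hcases' hnb
  · have hnb' : S.act x₁ (a - b) ∈ S.pos := by rwa [← map_neg, neg_sub] at hnb
    norm_num at hcases hcases'
    rcases hcases with rfl | rfl | rfl
    · rcases hcases' with rfl | rfl | rfl
      · rw [hp, one_smul] at hnd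
        exact absurd hnd (hcontra hnb')
      · have hs : c = (c - a) + a := by abel
        have key := WeylSetup.exists_bounds_of_isCoverRoot (x₁ := x₁) (x₂ := x₂) (α := c - a) (β := a) hSL
          (by rw [← hs, ← hyc, hyd]) (by rwa [← hs]) hxa
          (by rwa [← hs]) hxd
        rw [← hs, ← hya, ← hyc] at key
        obtain ⟨hu, z, hz, hz'⟩ := key
        exact ⟨hu, z, hz', hz⟩
      · rw [inner_sub_left, hp, hSL c hc] at hnd
        norm_num at hnd
        exact absurd hnd (hcontra hxa.act_pos)
    · rcases hcases' with rfl | rfl | rfl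
      · have hs : d = b + (d - b) := by abel
        have key := WeylSetup.exists_bounds_of_isCoverRoot (x₁ := x₁) (x₂ := x₂) (α := b) (β := d - b) hSL
          (by rw [← hs, ← hya, hyb]) (by rwa [← hs]) hxc
          (by rwa [← hs]) hxb
        rw [← hs, ← hya, ← hyc] at key
        exact key
      · exact absurd (by rw [neg_sub]; exact hxd.pos) (S.neg_notMem hxc.pos)
      · exact absurd rfl hcd
    · exact absurd hnb (hcontra hxc.act_pos)
  · norm_num at hcases
    subst hcases
    exact absurd hnb (hcontra hxc.act_pos)
  · norm_num at hcases
    rcases hcases with rfl | rfl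
    · have hr : c + a ∈ S.Φ := by
        have := S.act_root (S.sroot a) c hc
        rwa [S.act_sroot hSL ha, hba, hp, neg_one_smul, sub_neg_eq_add] at this
      have hr' := S.act_root x₁ _ hr
      refine absurd hnb (hcontra ?_)
      rw [map_add] at hr' ⊢
      exact S.add_mem hSL hxc.act_pos hxa.act_pos hr'
    · rw [add_comm] at hnb
      exact absurd hnb (hcontra hxc.act_pos)
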